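/- arXiv:2404.06754 — 2 statements merged into one kernel-verified Lean document; each statement's English description precedes it below -/
import Mathlib

section
/- Fix an odd integer n ≥ 3. There exists a constant C = C(n) > 0 such that the following holds. Let q be an odd prime power and let M, N be invertible symmetric n×n matrices over F_q such that N is not a scalar multiple of M, and set f(v) = vᵀMv, g(v) = vᵀNv. Then the number of nonzero vectors v ∈ F_q^n such that (−1)^{(n−1)/2}·det(M)·f(v) is a non-square in F_q and (−1)^{(n−1)/2}·det(N)·g(v) is a non-square in F_q satisfies |count − (q−1)·q^{n−1}/4| ≤ C·(q−1)·q^{n−3/2}. (Equivalently, the number of points P ∈ P^{n−1}(F_q) internal to {f=0} and internal to {g=0} is q^{n−1}/4 + O(q^{n−3/2}).) -/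
open Matrix

section QuadraticExponentialSums

variable {F ι : Type*} [Field F] [Fintype F] [Fintype ι] [DecidableEq ι]

/-- The exponential sum `∑ v, ψ(vᵀ A v)` attached to the quadratic form with matrix `A`. -/
noncomputable def quadExpSum (ψ : AddChar F ℂ) (A : Matrix ι ι F) : ℂ :=
  ∑ v : ι → F, ψ (v ⬝ᵥ A *ᵥ v)

theorem norm_sum_addChar_dotProduct_le {ψ : AddChar F ℂ} (hψ : ψ.IsPrimitive)
    [DecidableEq F] (c : ι → F) :
    ‖∑ w : ι → F, ψ (c ⬝ᵥ w)‖ ≤ if c = 0 then (Fintype.card F : ℝ) ^ Fintype.card ι else 0 := by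
  split_ifs with hc
  · simp [hc]
  · obtain ⟨i, hi⟩ := Function.ne_iff.1 hc
    let φ : AddChar (ι → F) ℂ :=
      ψ.compAddMonoidHom (AddMonoidHom.mk' (fun w ↦ c ⬝ᵥ w) (dotProduct_add c))
    have hφ : φ ≠ 0 := by
      obtain ⟨x, hx⟩ := AddChar.ne_one_iff.1 (hψ hi)
      refine AddChar.ne_one_iff.2 ⟨Pi.single i x, ?_⟩
      simpa [φ, AddChar.mulShift_apply] using hx
    have h := AddChar.sum_eq_zero_iff_ne_zero.2 hφ
    change ∑ w : ι → F, ψ (c ⬝ᵥ w) = 0 at h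
    simp [h]

theorem sq_norm_quadExpSum_le {ψ : AddChar F ℂ} (hψ : ψ.IsPrimitive) (h2 : (2 : F) ≠ 0)
    {A : Matrix ι ι F} (hA : A.IsSymm) :
    ‖quadExpSum ψ A‖ ^ 2 ≤
      (Fintype.card F : ℝ) ^ Fintype.card ι * Nat.card {u : ι → F // A *ᵥ u = 0} := by
  classical
  have key : quadExpSum ψ A * starRingEnd ℂ (quadExpSum ψ A) =
      ∑ u : ι → F, ψ (u ⬝ᵥ A *ᵥ u) * ∑ w : ι → F, ψ (((2 : F) • (A *ᵥ u)) ⬝ᵥ w) := by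
    unfold quadExpSum
    rw [map_sum, Finset.sum_mul_sum, Finset.sum_comm]
    simp_rw [Finset.mul_sum]
    conv_rhs => rw [Finset.sum_comm]
    refine Finset.sum_congr rfl fun w _ ↦ ?_
    rw [← Equiv.sum_comp (Equiv.addRight w)]
    refine Finset.sum_congr rfl fun u _ ↦ ?_
    rw [← AddChar.map_neg_eq_conj, ← AddChar.map_add_eq_mul, ← AddChar.map_add_eq_mul]
    congr 1
    have h : w ⬝ᵥ A *ᵥ u = u ⬝ᵥ A *ᵥ w := by
      rw [dotProduct_mulVec, ← mulVec_transpose, hA.eq, dotProduct_comm]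
    simp only [Equiv.coe_addRight, mulVec_add, dotProduct_add, add_dotProduct, smul_dotProduct,
      smul_eq_mul]
    rw [dotProduct_comm (A *ᵥ u) w, h]
    ring
  have hsq : ‖quadExpSum ψ A‖ ^ 2 = ‖quadExpSum ψ A * starRingEnd ℂ (quadExpSum ψ A)‖ := by
    rw [norm_mul, RCLike.norm_conj, sq]
  rw [hsq, key]
  calc _ ≤ ∑ u : ι → F, if A *ᵥ u = 0 then (Fintype.card F : ℝ) ^ Fintype.card ι else 0 := by
        refine (norm_sum_le _ _).trans (Finset.sum_le_sum fun u _ ↦ ?_)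
        rw [norm_mul, AddChar.norm_apply, one_mul]
        simpa [h2] using norm_sum_addChar_dotProduct_le hψ ((2 : F) • (A *ᵥ u))
    _ = _ := by
        rw [← Finset.sum_filter, Finset.sum_const, nsmul_eq_mul, mul_comm, Nat.card_eq_fintype_card,
          Fintype.card_subtype]

theorem norm_quadExpSum_le_of_isUnit_det {ψ : AddChar F ℂ} (hψ : ψ.IsPrimitive) (h2 : (2 : F) ≠ 0)
    {A : Matrix ι ι F} (hA : A.IsSymm) (hdet : IsUnit A.det) :
    ‖quadExpSum ψ A‖ ≤ √(Fintype.card F) ^ Fintype.card ι := by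
  have hker : Nat.card {u : ι → F // A *ᵥ u = 0} = 1 := by
    rw [Nat.card_eq_one_iff_unique]
    refine ⟨⟨fun x y ↦ Subtype.ext ?_⟩, ⟨⟨0, mulVec_zero A⟩⟩⟩
    exact (mulVec_injective_of_isUnit ((isUnit_iff_isUnit_det A).2 hdet)) (x.2.trans y.2.symm)
  have h := sq_norm_quadExpSum_le hψ h2 hA
  refine le_of_sq_le_sq ?_ (by positivity)
  rw [← pow_mul, mul_comm, pow_mul, Real.sq_sqrt (by positivity)]
  simpa [hker] using h

theorem norm_quadExpSum_le_of_ne_zero {ψ : AddChar F ℂ} (hψ : ψ.IsPrimitive) (h2 : (2 : F) ≠ 0)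
    {A : Matrix ι ι F} (hA : A.IsSymm) (h0 : A ≠ 0) :
    ‖quadExpSum ψ A‖ ≤ √(Fintype.card F) ^ (2 * Fintype.card ι - 1) := by
  classical
  have hι : 0 < Fintype.card ι := by
    rw [Fintype.card_pos_iff]
    by_contra h
    rw [not_nonempty_iff] at h
    exact h0 (Subsingleton.elim _ _)
  have hker : Nat.card {u : ι → F // A *ᵥ u = 0} ≤ Fintype.card F ^ (Fintype.card ι - 1) := by
    have hK : LinearMap.ker A.mulVecLin ≠ ⊤ := by
      rw [Ne, LinearMap.ker_eq_top]
      exact fun h ↦ h0 (Matrix.toLin'.injective (by simpa [Matrix.toLin'_apply'] using h))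
    have hlt := Submodule.finrank_lt hK
    rw [Module.finrank_fintype_fun_eq_card] at hlt
    have hc : Nat.card {u : ι → F // A *ᵥ u = 0} =
        Fintype.card F ^ Module.finrank F (LinearMap.ker A.mulVecLin) := by
      rw [← Nat.card_eq_fintype_card, ← Module.natCard_eq_pow_finrank]
      rfl
    rw [hc]
    exact Nat.pow_le_pow_right Fintype.card_pos (by omega)
  have h := sq_norm_quadExpSum_le hψ h2 hA
  refine le_of_sq_le_sq ?_ (by positivity)
  rw [← pow_mul, mul_comm, pow_mul, Real.sq_sqrt (by positivity)]
  refine h.trans ?_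
  rw [show 2 * Fintype.card ι - 1 = Fintype.card ι + (Fintype.card ι - 1) by omega, pow_add]
  gcongr
  exact_mod_cast hker

end QuadraticExponentialSums

section CharacterSums

variable {F ι : Type*} [Field F] [Fintype F] [DecidableEq F] [Fintype ι] [DecidableEq ι]

/-- The quadratic character of `F` with values in `ℂ`. -/
noncomputable abbrev complexQuadraticChar (F : Type*) [Field F] [Fintype F] [DecidableEq F] :
    MulChar F ℂ :=
  (quadraticChar F).ringHomComp (Int.castRingHom ℂ)

theorem complexQuadraticChar_ne_one (hF : ringChar F ≠ 2) : complexQuadraticChar F ≠ 1 :=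
  (MulChar.ringHomComp_ne_one_iff (Int.castRingHom ℂ).injective_int).2 (quadraticChar_ne_one hF)

theorem norm_complexQuadraticChar_le_one (a : F) : ‖complexQuadraticChar F a‖ ≤ 1 := by
  rcases quadraticChar_isQuadratic F a with h | h | h <;> simp [MulChar.ringHomComp_apply, h]

theorem norm_gaussSum_complexQuadraticChar (hF : ringChar F ≠ 2) {ψ : AddChar F ℂ}
    (hψ : ψ.IsPrimitive) :
    ‖gaussSum (complexQuadraticChar F) ψ‖ = √(Fintype.card F) := by
  have hs := gaussSum_sq (complexQuadraticChar_ne_one hF)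
    ((quadraticChar_isQuadratic F).comp (Int.castRingHom ℂ)) hψ
  have hn : ‖complexQuadraticChar F (-1)‖ = 1 := by
    rcases quadraticChar_dichotomy (F := F) (neg_ne_zero.2 one_ne_zero) with h | h <;>
      simp [MulChar.ringHomComp_apply, h]
  have h := congrArg norm hs
  rw [norm_pow, norm_mul, hn, one_mul, Complex.norm_natCast] at h
  rw [← h, Real.sqrt_sq (norm_nonneg _)]

theorem gaussSum_mul_complexQuadraticChar (hF : ringChar F ≠ 2) (ψ : AddChar F ℂ) (t : F) :
    gaussSum (complexQuadraticChar F) ψ * complexQuadraticChar F t =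
      ∑ a : F, complexQuadraticChar F a * ψ (a * t) := by
  rcases eq_or_ne t 0 with rfl | ht
  · simpa using (MulChar.sum_eq_zero_of_ne_one (complexQuadraticChar_ne_one hF)).symm
  · have h := gaussSum_mulShift_eq (complexQuadraticChar F) ψ (Units.mk0 t ht)
    rw [((quadraticChar_isQuadratic F).comp (Int.castRingHom ℂ)).inv, Units.val_mk0] at h
    rw [mul_comm, ← h, gaussSum]
    simp [AddChar.mulShift_apply, mul_comm]

theorem sqrt_card_mul_abs_sum_quadraticChar_le (hF : ringChar F ≠ 2)
    {A : Matrix ι ι F} (hA : A.IsSymm) (hdet : IsUnit A.det) :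
    √(Fintype.card F) * |((∑ v : ι → F, quadraticChar F (v ⬝ᵥ A *ᵥ v) : ℤ) : ℝ)| ≤
      Fintype.card F * √(Fintype.card F) ^ Fintype.card ι := by
  obtain ⟨ψ, hψ⟩ : ∃ ψ : AddChar F ℂ, ψ.IsPrimitive :=
    ⟨_, AddChar.FiniteField.primitiveChar_to_Complex_isPrimitive F⟩
  have h2 : (2 : F) ≠ 0 := Ring.two_ne_zero hF
  have key : gaussSum (complexQuadraticChar F) ψ *
      ((∑ v : ι → F, quadraticChar F (v ⬝ᵥ A *ᵥ v) : ℤ) : ℂ) =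
      ∑ a : F, complexQuadraticChar F a * quadExpSum ψ (a • A) := by
    push_cast
    simp_rw [quadExpSum, Finset.mul_sum]
    rw [Finset.sum_comm]
    refine Finset.sum_congr rfl fun v _ ↦ ?_
    simpa [smul_mulVec] using gaussSum_mul_complexQuadraticChar hF ψ (v ⬝ᵥ A *ᵥ v)
  rw [← Complex.norm_intCast, ← norm_gaussSum_complexQuadraticChar hF hψ, ← norm_mul, key,
    norm_gaussSum_complexQuadraticChar hF hψ]
  refine (norm_sum_le _ _).trans ?_
  rw [← nsmul_eq_mul, ← Finset.card_univ]
  refine Finset.sum_le_card_nsmul _ _ _ fun a _ ↦ ?_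
  rw [norm_mul]
  rcases eq_or_ne a 0 with rfl | ha
  · simp only [MulChar.map_zero, norm_zero, zero_mul]
    positivity
  · refine (mul_le_of_le_one_left (norm_nonneg _) (norm_complexQuadraticChar_le_one a)).trans ?_
    refine norm_quadExpSum_le_of_isUnit_det hψ h2 (hA.smul a) ?_
    rw [det_smul]
    exact ((isUnit_iff_ne_zero.2 ha).pow _).mul hdet

theorem card_det_add_smul_eq_zero_le (M : Matrix ι ι F) {N : Matrix ι ι F} (hN : IsUnit N.det)
    (a : F) :
    (Finset.univ.filter fun b : F ↦ (a • M + b • N).det = 0).card ≤ Fintype.card ι := by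
  set P := (-(a • (N⁻¹ * M))).charpoly with hP
  have hdeg : P.natDegree = Fintype.card ι := charpoly_natDegree_eq_dim _
  have hmonic : P.Monic := charpoly_monic _
  have hsub : (Finset.univ.filter fun b : F ↦ (a • M + b • N).det = 0) ⊆ P.roots.toFinset := by
    intro b hb
    rw [Finset.mem_filter] at hb
    rw [Multiset.mem_toFinset, Polynomial.mem_roots hmonic.ne_zero, Polynomial.IsRoot, hP,
      eval_charpoly]
    have hfac : a • M + b • N = N * (scalar ι b - -(a • (N⁻¹ * M))) := by
      rw [sub_neg_eq_add, mul_add, Matrix.mul_smul, mul_nonsing_inv_cancel_left _ _ hN, add_comm]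
      simp [← smul_one_eq_diagonal]
    have h := hb.2
    rw [hfac, det_mul] at h
    exact (mul_eq_zero.1 h).resolve_left hN.ne_zero
  calc _ ≤ P.roots.toFinset.card := Finset.card_le_card hsub
    _ ≤ Multiset.card P.roots := Multiset.toFinset_card_le _
    _ ≤ P.natDegree := P.card_roots'
    _ = _ := hdeg

theorem card_mul_abs_sum_quadraticChar_mul_le (hF : ringChar F ≠ 2)
    {M N : Matrix ι ι F} (hM : M.IsSymm) (hN : N.IsSymm) (hNdet : IsUnit N.det)
    (hne : ∀ c : F, N ≠ c • M) :
    Fintype.card F * |((∑ v : ι → F, quadraticChar F (v ⬝ᵥ M *ᵥ v) *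
        quadraticChar F (v ⬝ᵥ N *ᵥ v) : ℤ) : ℝ)| ≤
      Fintype.card F * (Fintype.card F * √(Fintype.card F) ^ Fintype.card ι +
        Fintype.card ι * √(Fintype.card F) ^ (2 * Fintype.card ι - 1)) := by
  obtain ⟨ψ, hψ⟩ : ∃ ψ : AddChar F ℂ, ψ.IsPrimitive :=
    ⟨_, AddChar.FiniteField.primitiveChar_to_Complex_isPrimitive F⟩
  have h2 : (2 : F) ≠ 0 := Ring.two_ne_zero hF
  set χ := complexQuadraticChar F with hχ
  have key : gaussSum χ ψ ^ 2 *
      ((∑ v : ι → F, quadraticChar F (v ⬝ᵥ M *ᵥ v) * quadraticChar F (v ⬝ᵥ N *ᵥ v) : ℤ) : ℂ) =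
      ∑ a : F, ∑ b : F, χ a * χ b * quadExpSum ψ (a • M + b • N) := by
    push_cast
    simp_rw [quadExpSum, Finset.mul_sum]
    rw [Finset.sum_congr rfl fun a _ ↦ Finset.sum_comm, Finset.sum_comm]
    refine Finset.sum_congr rfl fun v _ ↦ ?_
    have hx := gaussSum_mul_complexQuadraticChar hF ψ (v ⬝ᵥ M *ᵥ v)
    have hy := gaussSum_mul_complexQuadraticChar hF ψ (v ⬝ᵥ N *ᵥ v)
    have hxy := congrArg₂ (· * ·) hx hy
    simp only [Finset.sum_mul_sum] at hxy
    calc _ = gaussSum χ ψ * χ (v ⬝ᵥ M *ᵥ v) * (gaussSum χ ψ * χ (v ⬝ᵥ N *ᵥ v)) := by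
          simp only [hχ, MulChar.ringHomComp_apply, eq_intCast]
          ring
      _ = _ := hxy
      _ = _ := by
          refine Finset.sum_congr rfl fun a _ ↦ Finset.sum_congr rfl fun b _ ↦ ?_
          simp only [add_mulVec, smul_mulVec, dotProduct_add, dotProduct_smul, smul_eq_mul,
            AddChar.map_add_eq_mul]
          ring
  have hG : ‖gaussSum χ ψ ^ 2‖ = Fintype.card F := by
    rw [norm_pow, norm_gaussSum_complexQuadraticChar hF hψ, Real.sq_sqrt (by positivity)]
  rw [← Complex.norm_intCast, ← hG, ← norm_mul, key, hG]
  refine (norm_sum_le _ _).trans ?_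
  conv_rhs => rw [← nsmul_eq_mul, ← Finset.card_univ]
  refine Finset.sum_le_card_nsmul _ _ _ fun a _ ↦ (norm_sum_le _ _).trans ?_
  set s := √(Fintype.card F : ℝ) with hs
  have hs0 : 0 ≤ s := Real.sqrt_nonneg _
  calc _ ≤ ∑ b : F, (s ^ Fintype.card ι +
          if (a • M + b • N).det = 0 then s ^ (2 * Fintype.card ι - 1) else 0) := by
        refine Finset.sum_le_sum fun b _ ↦ ?_
        have hpos : 0 ≤ s ^ Fintype.card ι +
            if (a • M + b • N).det = 0 then s ^ (2 * Fintype.card ι - 1) else 0 := by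
          split_ifs <;> positivity
        rcases eq_or_ne b 0 with rfl | hb
        · simpa only [MulChar.map_zero, mul_zero, zero_mul, norm_zero] using hpos
        have hle : ‖χ a * χ b * quadExpSum ψ (a • M + b • N)‖ ≤ ‖quadExpSum ψ (a • M + b • N)‖ := by
          rw [norm_mul, norm_mul]
          exact mul_le_of_le_one_left (norm_nonneg _) (mul_le_one₀
            (norm_complexQuadraticChar_le_one a) (norm_nonneg _)
            (norm_complexQuadraticChar_le_one b))
        refine hle.trans ?_
        have hsymm : (a • M + b • N).IsSymm := (hM.smul a).add (hN.smul b)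
        split_ifs with hdet
        · refine (norm_quadExpSum_le_of_ne_zero hψ h2 hsymm fun h0 ↦ ?_).trans
            (le_add_of_nonneg_left (by positivity))
          refine hne (-(b⁻¹ * a)) ?_
          have h1 : b • N = -(a • M) := eq_neg_of_add_eq_zero_right h0
          rw [neg_smul, mul_smul, ← smul_neg, ← h1, smul_smul, inv_mul_cancel₀ hb, one_smul]
        · rw [add_zero]
          exact norm_quadExpSum_le_of_isUnit_det hψ h2 hsymm (isUnit_iff_ne_zero.2 hdet)
    _ ≤ _ := by
        rw [Finset.sum_add_distrib, ← Finset.sum_filter, Finset.sum_const, Finset.sum_const,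
          Finset.card_univ, nsmul_eq_mul, nsmul_eq_mul]
        gcongr
        exact card_det_add_smul_eq_zero_le M hNdet a

theorem card_mul_card_quadric_le (hF : ringChar F ≠ 2)
    {A : Matrix ι ι F} (hA : A.IsSymm) (hdet : IsUnit A.det) :
    (Fintype.card F : ℝ) * (Finset.univ.filter fun v : ι → F ↦ v ⬝ᵥ A *ᵥ v = 0).card ≤
      (Fintype.card F : ℝ) ^ Fintype.card ι +
        Fintype.card F * √(Fintype.card F) ^ Fintype.card ι := by
  obtain ⟨ψ, hψ⟩ : ∃ ψ : AddChar F ℂ, ψ.IsPrimitive :=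
    ⟨_, AddChar.FiniteField.primitiveChar_to_Complex_isPrimitive F⟩
  have h2 : (2 : F) ≠ 0 := Ring.two_ne_zero hF
  have key : ((Fintype.card F * (Finset.univ.filter fun v : ι → F ↦ v ⬝ᵥ A *ᵥ v = 0).card : ℝ) : ℂ)
      = ∑ a : F, quadExpSum ψ (a • A) := by
    unfold quadExpSum
    rw [Finset.sum_comm]
    have h : ∀ v : ι → F, ∑ a : F, ψ (v ⬝ᵥ (a • A) *ᵥ v) =
        if v ⬝ᵥ A *ᵥ v = 0 then (Fintype.card F : ℂ) else 0 := fun v ↦ by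
      simpa [smul_mulVec] using AddChar.sum_mulShift (v ⬝ᵥ A *ᵥ v) hψ
    simp_rw [h]
    rw [← Finset.sum_filter, Finset.sum_const, nsmul_eq_mul]
    push_cast
    ring
  have hn := congrArg norm key
  rw [Complex.norm_real, Real.norm_of_nonneg (by positivity)] at hn
  rw [hn, ← Finset.add_sum_erase _ _ (Finset.mem_univ (0 : F))]
  refine (norm_add_le _ _).trans (add_le_add ?_ ((norm_sum_le _ _).trans ?_))
  · simp [quadExpSum]
  · calc _ ≤ ∑ a ∈ Finset.univ.erase (0 : F), √(Fintype.card F : ℝ) ^ Fintype.card ι := by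
          refine Finset.sum_le_sum fun a ha ↦ ?_
          refine norm_quadExpSum_le_of_isUnit_det hψ h2 (hA.smul a) ?_
          rw [det_smul]
          exact ((isUnit_iff_ne_zero.2 (Finset.ne_of_mem_erase ha)).pow _).mul hdet
      _ ≤ ∑ a : F, √(Fintype.card F : ℝ) ^ Fintype.card ι :=
          Finset.sum_le_sum_of_subset_of_nonneg (Finset.erase_subset _ _)
            fun _ _ _ ↦ by positivity
      _ = _ := by simp

end CharacterSums

section Counting

variable {F ι : Type*} [Field F] [Fintype F] [DecidableEq F] [Fintype ι] [DecidableEq ι]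

theorem card_quadric_le (hF : ringChar F ≠ 2) (hι : 2 ≤ Fintype.card ι)
    {A : Matrix ι ι F} (hA : A.IsSymm) (hdet : IsUnit A.det) :
    ((Finset.univ.filter fun v : ι → F ↦ v ⬝ᵥ A *ᵥ v = 0).card : ℝ) ≤
      2 * √(Fintype.card F) ^ (2 * Fintype.card ι - 1) := by
  have h := card_mul_card_quadric_le hF hA hdet
  have hs1 : 1 ≤ √(Fintype.card F : ℝ) :=
    Real.one_le_sqrt.2 (by exact_mod_cast Fintype.card_pos (α := F))
  have hs : (Fintype.card F : ℝ) = √(Fintype.card F) ^ 2 := (Real.sq_sqrt (by positivity)).symm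
  set s := √(Fintype.card F : ℝ)
  rw [hs] at h
  refine le_of_mul_le_mul_left (h.trans ?_) (by positivity : 0 < s ^ 2)
  rw [← pow_mul, ← pow_add, mul_left_comm, ← pow_add, two_mul (s ^ _)]
  exact add_le_add (pow_le_pow_right₀ hs1 (by omega)) (pow_le_pow_right₀ hs1 (by omega))

theorem abs_sum_quadraticChar_le (hF : ringChar F ≠ 2) (hι : 2 ≤ Fintype.card ι)
    {A : Matrix ι ι F} (hA : A.IsSymm) (hdet : IsUnit A.det) :
    |∑ v : ι → F, (quadraticChar F (v ⬝ᵥ A *ᵥ v) : ℝ)| ≤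
      √(Fintype.card F) ^ (2 * Fintype.card ι - 1) := by
  have h := sqrt_card_mul_abs_sum_quadraticChar_le hF hA hdet
  push_cast at h
  have hs1 : 1 ≤ √(Fintype.card F : ℝ) :=
    Real.one_le_sqrt.2 (by exact_mod_cast Fintype.card_pos (α := F))
  have hs : (Fintype.card F : ℝ) = √(Fintype.card F) ^ 2 := (Real.sq_sqrt (by positivity)).symm
  set s := √(Fintype.card F : ℝ)
  rw [hs, ← pow_add] at h
  refine le_of_mul_le_mul_left (h.trans ?_) (by positivity : 0 < s)
  rw [← pow_succ']
  exact pow_le_pow_right₀ hs1 (by omega)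

theorem abs_sum_quadraticChar_mul_le (hF : ringChar F ≠ 2) (hι : 3 ≤ Fintype.card ι)
    {M N : Matrix ι ι F} (hM : M.IsSymm) (hN : N.IsSymm) (hNdet : IsUnit N.det)
    (hne : ∀ c : F, N ≠ c • M) :
    |∑ v : ι → F, (quadraticChar F (v ⬝ᵥ M *ᵥ v) : ℝ) * quadraticChar F (v ⬝ᵥ N *ᵥ v)| ≤
      (Fintype.card ι + 1) * √(Fintype.card F) ^ (2 * Fintype.card ι - 1) := by
  have h := card_mul_abs_sum_quadraticChar_mul_le hF hM hN hNdet hne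
  push_cast at h
  have h' := le_of_mul_le_mul_left h (by exact_mod_cast Fintype.card_pos (α := F))
  have hs1 : 1 ≤ √(Fintype.card F : ℝ) :=
    Real.one_le_sqrt.2 (by exact_mod_cast Fintype.card_pos (α := F))
  have hs : (Fintype.card F : ℝ) = √(Fintype.card F) ^ 2 := (Real.sq_sqrt (by positivity)).symm
  refine h'.trans ?_
  rw [add_one_mul, add_comm]
  gcongr
  set s := √(Fintype.card F : ℝ)
  rw [hs, ← pow_add]
  exact pow_le_pow_right₀ hs1 (by omega)

theorem abs_four_mul_indicator_sub_le (x y : F) :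
    |4 * (if ¬ IsSquare x ∧ ¬ IsSquare y then (1 : ℝ) else 0) -
        (1 - quadraticChar F x - quadraticChar F y + quadraticChar F x * quadraticChar F y)| ≤
      2 * (if x = 0 then 1 else 0) + 2 * (if y = 0 then 1 else 0) := by
  simp only [← quadraticChar_neg_one_iff_not_isSquare, ← quadraticChar_eq_zero_iff (F := F)]
  rcases quadraticChar_isQuadratic F x with h | h | h <;>
    rcases quadraticChar_isQuadratic F y with h' | h' | h' <;> norm_num [h, h']

theorem abs_four_mul_card_nonsquare_sub_le (hF : ringChar F ≠ 2) (hι : 3 ≤ Fintype.card ι)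
    {M N : Matrix ι ι F} (hM : M.IsSymm) (hN : N.IsSymm) (hMdet : IsUnit M.det)
    (hNdet : IsUnit N.det) (hne : ∀ c : F, N ≠ c • M) :
    |4 * ({v : ι → F | v ≠ 0 ∧ ¬ IsSquare (v ⬝ᵥ M *ᵥ v) ∧ ¬ IsSquare (v ⬝ᵥ N *ᵥ v)}.ncard : ℝ) -
        (Fintype.card F : ℝ) ^ Fintype.card ι| ≤
      (Fintype.card ι + 11) * √(Fintype.card F) ^ (2 * Fintype.card ι - 1) := by
  set f : (ι → F) → F := fun v ↦ v ⬝ᵥ M *ᵥ v with hf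
  set g : (ι → F) → F := fun v ↦ v ⬝ᵥ N *ᵥ v with hg
  have hset : {v : ι → F | v ≠ 0 ∧ ¬ IsSquare (f v) ∧ ¬ IsSquare (g v)} =
      ↑(Finset.univ.filter fun v ↦ ¬ IsSquare (f v) ∧ ¬ IsSquare (g v)) := by
    ext v
    simp only [Set.mem_ofPred_eq, Finset.coe_filter, Finset.mem_univ, true_and,
      and_iff_right_iff_imp]
    rintro ⟨h, -⟩ rfl
    exact h (by simp [hf])
  have hf0 := card_quadric_le hF (by omega) hM hMdet
  have hg0 := card_quadric_le hF (by omega) hN hNdet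
  have hf1 := abs_sum_quadraticChar_le hF (by omega) hM hMdet
  have hg1 := abs_sum_quadraticChar_le hF (by omega) hN hNdet
  have hfg := abs_sum_quadraticChar_mul_le hF hι hM hN hNdet hne
  have herr : |∑ v : ι → F, (4 * (if ¬ IsSquare (f v) ∧ ¬ IsSquare (g v) then (1 : ℝ) else 0) -
      (1 - quadraticChar F (f v) - quadraticChar F (g v) +
        quadraticChar F (f v) * quadraticChar F (g v)))| ≤
      ∑ v : ι → F, (2 * (if f v = 0 then 1 else 0) + 2 * (if g v = 0 then 1 else 0)) :=
    (Finset.abs_sum_le_sum_abs _ _).trans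
      (Finset.sum_le_sum fun v _ ↦ abs_four_mul_indicator_sub_le _ _)
  simp only [Finset.sum_sub_distrib, Finset.sum_add_distrib, ← Finset.mul_sum, Finset.sum_boole,
    Finset.sum_const, Finset.card_univ, Fintype.card_fun, nsmul_eq_mul, mul_one,
    Nat.cast_pow] at herr
  rw [hset, Set.ncard_coe_finset]
  rw [abs_le] at *
  constructor <;> linarith

end Counting

/-- Remark 1.3(i): for a fixed odd `n ≥ 3`, the number of points of `ℙ^{n-1}(F_q)` internal to
the smooth quadric `{f = 0}` and internal to the smooth quadric `{g = 0}` is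
`q^{n-1}/4 + O(q^{n-3/2})`, expressed via counts of nonzero vectors. -/
theorem internal_internal_count (n : ℕ) (hodd : Odd n) (hn : 3 ≤ n) :
    ∃ C : ℝ, 0 < C ∧
      ∀ (q : ℕ) (F : Type) [Field F] [Fintype F],
        Fintype.card F = q → Odd q →
        ∀ M N : Matrix (Fin n) (Fin n) F,
          M.IsSymm → N.IsSymm → IsUnit M.det → IsUnit N.det →
          (∀ c : F, N ≠ c • M) →
          abs (({v : Fin n → F | v ≠ 0 ∧
                ¬ IsSquare ((-1) ^ ((n - 1) / 2) * M.det * (v ⬝ᵥ M.mulVec v)) ∧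
                ¬ IsSquare ((-1) ^ ((n - 1) / 2) * N.det * (v ⬝ᵥ N.mulVec v))}.ncard : ℝ)
              - ((q : ℝ) - 1) * (q : ℝ) ^ (n - 1) / 4)
            ≤ C * ((q : ℝ) - 1) * (q : ℝ) ^ ((n : ℝ) - 3 / 2) := by
  refine ⟨n + 12, by positivity, ?_⟩
  intro q F _ _ hq hqodd M N hM hN hMdet hNdet hne
  classical
  have hF : ringChar F ≠ 2 := fun h ↦ by
    have := FiniteField.even_card_iff_char_two.1 h
    rw [hq, ← Nat.even_iff] at this
    exact Nat.not_even_iff_odd.2 hqodd this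
  have hε : ((-1 : F) ^ ((n - 1) / 2)) ≠ 0 := pow_ne_zero _ (neg_ne_zero.2 one_ne_zero)
  set a := (-1 : F) ^ ((n - 1) / 2) * M.det
  set b := (-1 : F) ^ ((n - 1) / 2) * N.det
  have ha : a ≠ 0 := mul_ne_zero hε hMdet.ne_zero
  have hb : b ≠ 0 := mul_ne_zero hε hNdet.ne_zero
  have hdet : ∀ {c : F} {A : Matrix (Fin n) (Fin n) F}, c ≠ 0 → IsUnit A.det →
      IsUnit (c • A).det := fun hc hA ↦ by
    rw [det_smul]
    exact ((isUnit_iff_ne_zero.2 hc).pow _).mul hA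
  have hne' : ∀ c : F, b • N ≠ c • a • M := fun c h ↦ hne (b⁻¹ * (c * a)) <| by
    rw [mul_smul, mul_smul, ← h, inv_smul_smul₀ hb]
  have h := abs_four_mul_card_nonsquare_sub_le hF (by simpa using hn) (hM.smul a) (hN.smul b)
    (hdet ha hMdet) (hdet hb hNdet) hne'
  simp only [smul_mulVec, dotProduct_smul, smul_eq_mul, Fintype.card_fin, hq] at h
  have hq2 : (2 : ℝ) ≤ q := by
    have : 1 < q := hq ▸ Fintype.one_lt_card
    exact_mod_cast this
  have hq0 : (0 : ℝ) < q := by linarith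
  have hpow : √(q : ℝ) ^ (2 * n - 1) = q * (q : ℝ) ^ ((n : ℝ) - 3 / 2) := by
    rw [Real.sqrt_eq_rpow, ← Real.rpow_natCast, ← Real.rpow_mul hq0.le]
    nth_rewrite 2 [← Real.rpow_one (q : ℝ)]
    rw [← Real.rpow_add hq0, Nat.cast_sub (by omega)]
    congr 1
    push_cast
    ring
  have hlow : (q : ℝ) ^ (n - 1) ≤ q * (q : ℝ) ^ ((n : ℝ) - 3 / 2) := by
    rw [← hpow]
    have hs1 : 1 ≤ √(q : ℝ) := Real.one_le_sqrt.2 (by linarith)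
    calc (q : ℝ) ^ (n - 1) = √(q : ℝ) ^ (2 * (n - 1)) := by rw [pow_mul, Real.sq_sqrt hq0.le]
      _ ≤ _ := pow_le_pow_right₀ hs1 (by omega)
  have hmain : (q : ℝ) ^ n = q * (q : ℝ) ^ (n - 1) := by
    rw [← pow_succ', Nat.sub_add_cancel (by omega)]
  rw [hpow, hmain] at h
  have hP : 0 < (q : ℝ) ^ (n - 1) := by positivity
  have hT : 0 ≤ ((n : ℝ) + 12) * (q : ℝ) ^ ((n : ℝ) - 3 / 2) := by positivity
  have hqT := mul_le_mul_of_nonneg_right (show (q : ℝ) ≤ 2 * (q - 1) by linarith) hT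
  rw [abs_le] at h ⊢
  constructor <;> nlinarith
end

section
/- Let q ≥ 7 be an odd prime power and let n ≥ 3. Let M and N be invertible symmetric n×n matrices over F_q such that N is not a scalar multiple of M (so the smooth quadrics {f=0} and {g=0} in P^{n−1} are distinct, where f(v) = vᵀMv and g(v) = vᵀNv). Let χ be the quadratic character of F_q. Then |Σ_{v ∈ F_q^n, v ≠ 0} χ(f(v)·g(v))| ≤ (q−1)·(3·8^{n+1}·q^{(2n−3)/2} + 2·q^{n−2}). -/
open Matrix Finset

/- The quadratic character of a finite field, real-valued: `1` on nonzero squares,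
`-1` on non-squares, `0` at `0`. -/
open Classical in
noncomputable def quadChar {F : Type*} [Field F] (a : F) : ℝ :=
  if a = 0 then 0 else if IsSquare a then 1 else -1

theorem AddChar.IsPrimitive.sum_dotProduct {F ι : Type*} [Field F] [Fintype F] [DecidableEq F]
    [Fintype ι] [DecidableEq ι] {ψ : AddChar F ℂ} (hψ : ψ.IsPrimitive) (u : ι → F) :
    ∑ w : ι → F, ψ (w ⬝ᵥ u) = if u = 0 then (Fintype.card F : ℂ) ^ Fintype.card ι else 0 := by
  split_ifs with hu
  · simp [hu]
  · let φ : AddChar (ι → F) ℂ :=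
      { toFun := fun w => ψ (w ⬝ᵥ u)
        map_zero_eq_one' := by simp
        map_add_eq_mul' := fun a b => by simp [add_dotProduct, AddChar.map_add_eq_mul] }
    refine AddChar.sum_eq_zero_of_ne_one (ψ := φ) ?_
    obtain ⟨i, hi⟩ := Function.ne_iff.mp hu
    obtain ⟨x, hx⟩ := AddChar.ne_one_iff.mp (hψ hi)
    refine AddChar.ne_one_iff.mpr ⟨Pi.single i x, ?_⟩
    change ψ (Pi.single i x ⬝ᵥ u) ≠ 1
    simpa [mul_comm] using hx

theorem Matrix.IsSymm.norm_sq_sum_addChar_le {F ι : Type*} [Field F] [Fintype F] [DecidableEq F]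
    [Fintype ι] [DecidableEq ι] (hF : (2 : F) ≠ 0) {ψ : AddChar F ℂ} (hψ : ψ.IsPrimitive)
    {Q : Matrix ι ι F} (hQ : Q.IsSymm) :
    ‖∑ v : ι → F, ψ (v ⬝ᵥ Q *ᵥ v)‖ ^ 2
      ≤ (Fintype.card F : ℝ) ^ Fintype.card ι * #{h : ι → F | Q *ᵥ h = 0} := by
  have expand (w h : ι → F) : (w + h) ⬝ᵥ Q *ᵥ (w + h) - w ⬝ᵥ Q *ᵥ w
      = h ⬝ᵥ Q *ᵥ h + w ⬝ᵥ ((2 : F) • Q *ᵥ h) := by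
    have hsymm : h ⬝ᵥ Q *ᵥ w = w ⬝ᵥ Q *ᵥ h := by
      rw [dotProduct_mulVec, ← mulVec_transpose, hQ.eq, dotProduct_comm]
    simp only [mulVec_add, add_dotProduct, dotProduct_add, dotProduct_smul, smul_eq_mul, hsymm]
    ring
  have key : (∑ v : ι → F, ψ (v ⬝ᵥ Q *ᵥ v)) *
      (starRingEnd ℂ) (∑ v : ι → F, ψ (v ⬝ᵥ Q *ᵥ v))
      = ∑ h : ι → F, ψ (h ⬝ᵥ Q *ᵥ h) * ∑ w : ι → F, ψ (w ⬝ᵥ ((2 : F) • Q *ᵥ h)) := by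
    rw [map_sum, sum_mul_sum, sum_comm]
    simp_rw [mul_sum]
    conv_rhs => rw [sum_comm]
    refine sum_congr rfl fun w _ => ?_
    rw [← Equiv.sum_comp (Equiv.addLeft w)]
    refine sum_congr rfl fun h _ => ?_
    rw [← AddChar.map_neg_eq_conj, ← AddChar.map_add_eq_mul, ← AddChar.map_add_eq_mul,
      ← sub_eq_add_neg, Equiv.coe_addLeft, ← expand]
  calc ‖∑ v : ι → F, ψ (v ⬝ᵥ Q *ᵥ v)‖ ^ 2
      = ‖(∑ v : ι → F, ψ (v ⬝ᵥ Q *ᵥ v)) *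
          (starRingEnd ℂ) (∑ v : ι → F, ψ (v ⬝ᵥ Q *ᵥ v))‖ := by
        rw [norm_mul, RCLike.norm_conj, sq]
    _ ≤ ∑ h : ι → F, ‖∑ w : ι → F, ψ (w ⬝ᵥ ((2 : F) • Q *ᵥ h))‖ := by
        rw [key]
        refine (norm_sum_le _ _).trans (sum_le_sum fun h _ => ?_)
        rw [norm_mul, AddChar.norm_apply, one_mul]
    _ = ∑ h : ι → F, if Q *ᵥ h = 0 then (Fintype.card F : ℝ) ^ Fintype.card ι else 0 := by
        refine sum_congr rfl fun h _ => ?_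
        rw [hψ.sum_dotProduct]
        simp only [smul_eq_zero, hF, false_or]
        split_ifs <;> simp
    _ = _ := by
        rw [← sum_filter, sum_const, nsmul_eq_mul, mul_comm]

theorem Matrix.card_mulVec_eq_zero_mul_card_le {F ι : Type*} [Field F] [Fintype F] [DecidableEq F]
    [Fintype ι] [DecidableEq ι] {Q : Matrix ι ι F} (hQ : Q ≠ 0) :
    #{h : ι → F | Q *ᵥ h = 0} * Fintype.card F ≤ Fintype.card F ^ Fintype.card ι := by
  let K := LinearMap.ker Q.mulVecLin
  have hK : K ≠ ⊤ := by
    intro h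
    apply hQ
    apply Matrix.toLin'.injective
    rw [map_zero]
    exact LinearMap.ker_eq_top.mp h
  have hlt := Submodule.finrank_lt hK
  rw [Module.finrank_fintype_fun_eq_card] at hlt
  have hcard : #{h : ι → F | Q *ᵥ h = 0} = Fintype.card F ^ Module.finrank F K := by
    rw [← Nat.card_eq_fintype_card (α := F), ← Module.natCard_eq_pow_finrank,
      ← Fintype.card_subtype, ← Nat.card_eq_fintype_card]
    rfl
  rw [hcard, ← pow_succ]
  exact Nat.pow_le_pow_right Fintype.card_pos hlt

theorem Matrix.card_det_smul_add_smul_eq_zero_le {F ι : Type*} [Field F] [Fintype F]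
    [DecidableEq F] [Fintype ι] [DecidableEq ι] {M : Matrix ι ι F} (hM : M.det ≠ 0)
    (N : Matrix ι ι F) {s : F} (hs : s ≠ 0) :
    #{t : F | (s • M + t • N).det = 0} ≤ Fintype.card ι := by
  let p : Polynomial F :=
    det ((Polynomial.X : Polynomial F) • N.map Polynomial.C + (s • M).map Polynomial.C)
  have hp : p ≠ 0 := by
    intro h
    have h0 := Polynomial.coeff_det_X_add_C_zero N (s • M)
    rw [show det ((Polynomial.X : Polynomial F) • N.map Polynomial.C
      + (s • M).map Polynomial.C) = 0 from h, Polynomial.coeff_zero, det_smul] at h0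
    exact mul_ne_zero (pow_ne_zero _ hs) hM h0.symm
  have heval (t : F) : p.eval t = (s • M + t • N).det := by
    simp only [p]
    rw [← Polynomial.coe_evalRingHom, RingHom.map_det]
    congr 1
    ext i j
    simp [add_comm, mul_comm t]
  calc #{t : F | (s • M + t • N).det = 0} ≤ #p.roots.toFinset := by
        refine card_le_card fun t ht => ?_
        rw [mem_filter] at ht
        simp [hp, Polynomial.IsRoot, heval, ht.2]
    _ ≤ p.natDegree := (Multiset.toFinset_card_le _).trans p.card_roots'
    _ ≤ Fintype.card ι := Polynomial.natDegree_det_X_add_C_le _ _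

theorem MulChar.IsQuadratic.apply_mul_gaussSum {F : Type*} [Field F] [Fintype F]
    {χ : MulChar F ℂ} (hχ : χ.IsQuadratic) (hχ1 : χ ≠ 1) (ψ : AddChar F ℂ) (x : F) :
    χ x * gaussSum χ ψ = ∑ s, χ s * ψ (s * x) := by
  have h : χ x * gaussSum χ ψ = gaussSum χ (ψ.mulShift x) := by
    rcases eq_or_ne x 0 with rfl | hx
    · rw [AddChar.mulShift_zero, gaussSum_one_right hχ1, MulChar.map_zero, zero_mul]
    · have := gaussSum_mulShift_eq χ ψ (Units.mk0 x hx)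
      rw [hχ.inv] at this
      exact this.symm
  rw [h, gaussSum]
  simp only [AddChar.mulShift_apply, mul_comm x]

theorem norm_sum_mulChar_quadratic_mul_le {F ι : Type*} [Field F] [Fintype F] [DecidableEq F]
    [Fintype ι] [DecidableEq ι] {χ : MulChar F ℂ} (hχ : χ.IsQuadratic) (hχ1 : χ ≠ 1)
    {ψ : AddChar F ℂ} (hψ : ψ.IsPrimitive) (M N : Matrix ι ι F) :
    Fintype.card F * ‖∑ v : ι → F, χ ((v ⬝ᵥ M *ᵥ v) * (v ⬝ᵥ N *ᵥ v))‖
      ≤ ∑ s : F with s ≠ 0, ∑ t : F with t ≠ 0,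
          ‖∑ v : ι → F, ψ (v ⬝ᵥ (s • M + t • N) *ᵥ v)‖ := by
  have hnorm (s : F) : ‖χ s‖ = if s ≠ 0 then 1 else 0 := by
    split_ifs with hs
    · rcases hχ s with h | h | h
      · exact absurd h ((Ne.isUnit hs).map χ).ne_zero
      · simp [h]
      · simp [h]
    · rw [not_not.mp hs, MulChar.map_zero, norm_zero]
  have hG : ‖gaussSum χ ψ ^ 2‖ = Fintype.card F := by
    rw [gaussSum_sq hχ1 hχ hψ, norm_mul, hnorm]
    simp
  have key : gaussSum χ ψ ^ 2 * ∑ v : ι → F, χ ((v ⬝ᵥ M *ᵥ v) * (v ⬝ᵥ N *ᵥ v))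
      = ∑ s, ∑ t, χ s * χ t * ∑ v : ι → F, ψ (v ⬝ᵥ (s • M + t • N) *ᵥ v) := by
    calc _ = ∑ v : ι → F, ∑ s, ∑ t, χ s * χ t * ψ (v ⬝ᵥ (s • M + t • N) *ᵥ v) := by
          rw [mul_sum]
          refine sum_congr rfl fun v _ => ?_
          rw [map_mul, show ∀ a b g : ℂ, g ^ 2 * (a * b) = (a * g) * (b * g) by intros; ring,
            hχ.apply_mul_gaussSum hχ1, hχ.apply_mul_gaussSum hχ1, sum_mul_sum]
          refine sum_congr rfl fun s _ => sum_congr rfl fun t _ => ?_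
          simp only [add_mulVec, smul_mulVec, dotProduct_add, dotProduct_smul, smul_eq_mul,
            AddChar.map_add_eq_mul]
          ring
      _ = _ := by
          rw [sum_comm]
          refine sum_congr rfl fun s _ => ?_
          rw [sum_comm]
          exact sum_congr rfl fun t _ => (mul_sum _ _ _).symm
  rw [← hG, ← norm_mul, key]
  refine (norm_sum_le _ _).trans ?_
  rw [sum_filter]
  refine sum_le_sum fun s _ => (norm_sum_le _ _).trans ?_
  simp only [norm_mul, hnorm]
  split_ifs with hs
  · rw [sum_filter]
    refine sum_le_sum fun t _ => ?_
    split_ifs <;> simp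
  · simp

theorem Matrix.IsSymm.norm_sum_addChar_le_of_det_ne_zero {F ι : Type*} [Field F] [Fintype F]
    [DecidableEq F] [Fintype ι] [DecidableEq ι] (hF : (2 : F) ≠ 0) {ψ : AddChar F ℂ}
    (hψ : ψ.IsPrimitive) {Q : Matrix ι ι F} (hQ : Q.IsSymm) (hdet : Q.det ≠ 0) :
    ‖∑ v : ι → F, ψ (v ⬝ᵥ Q *ᵥ v)‖ ≤ √(Fintype.card F) ^ Fintype.card ι := by
  have hker : #{h : ι → F | Q *ᵥ h = 0} ≤ 1 := by
    refine card_le_one.mpr fun a ha b hb => ?_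
    rw [mem_filter] at ha hb
    rw [Matrix.eq_zero_of_mulVec_eq_zero hdet ha.2, Matrix.eq_zero_of_mulVec_eq_zero hdet hb.2]
  refine le_of_sq_le_sq ?_ (by positivity)
  rw [← pow_mul, mul_comm, pow_mul, Real.sq_sqrt (Nat.cast_nonneg _)]
  refine (hQ.norm_sq_sum_addChar_le hF hψ).trans (mul_le_of_le_one_right (by positivity) ?_)
  exact_mod_cast hker

theorem Matrix.IsSymm.norm_sum_addChar_le_of_ne_zero {F ι : Type*} [Field F] [Fintype F]
    [DecidableEq F] [Fintype ι] [DecidableEq ι] (hF : (2 : F) ≠ 0) {ψ : AddChar F ℂ}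
    (hψ : ψ.IsPrimitive) {Q : Matrix ι ι F} (hQ : Q.IsSymm) (hQ0 : Q ≠ 0) :
    √(Fintype.card F) * ‖∑ v : ι → F, ψ (v ⬝ᵥ Q *ᵥ v)‖
      ≤ √(Fintype.card F) ^ (2 * Fintype.card ι) := by
  refine le_of_sq_le_sq ?_ (by positivity)
  rw [mul_pow, pow_mul, Real.sq_sqrt (Nat.cast_nonneg _), sq (_ ^ _)]
  calc (Fintype.card F : ℝ) * ‖∑ v : ι → F, ψ (v ⬝ᵥ Q *ᵥ v)‖ ^ 2
      ≤ Fintype.card F * ((Fintype.card F : ℝ) ^ Fintype.card ι * #{h : ι → F | Q *ᵥ h = 0}) :=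
        mul_le_mul_of_nonneg_left (hQ.norm_sq_sum_addChar_le hF hψ) (Nat.cast_nonneg _)
    _ = (Fintype.card F : ℝ) ^ Fintype.card ι *
          ((#{h : ι → F | Q *ᵥ h = 0} : ℝ) * Fintype.card F) := by ring
    _ ≤ _ := mul_le_mul_of_nonneg_left
        (by exact_mod_cast Matrix.card_mulVec_eq_zero_mul_card_le hQ0) (by positivity)

theorem sum_norm_sum_addChar_pencil_le {F ι : Type*} [Field F] [Fintype F]
    [DecidableEq F] [Fintype ι] [DecidableEq ι] (hF : (2 : F) ≠ 0) (hι : 3 ≤ Fintype.card ι)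
    {ψ : AddChar F ℂ} (hψ : ψ.IsPrimitive) {M N : Matrix ι ι F} (hM : M.IsSymm) (hN : N.IsSymm)
    (hMdet : M.det ≠ 0) (hMN : ∀ c : F, N ≠ c • M) {s : F} (hs : s ≠ 0) :
    ∑ t : F with t ≠ 0, ‖∑ v : ι → F, ψ (v ⬝ᵥ (s • M + t • N) *ᵥ v)‖
      ≤ (Fintype.card ι + 1) * √(Fintype.card F) ^ (2 * Fintype.card ι - 1) := by
  set r := √(Fintype.card F : ℝ)
  set k := Fintype.card ι
  have hr : 1 ≤ r := Real.one_le_sqrt.mpr (by exact_mod_cast Fintype.card_pos)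
  have hr2 : (Fintype.card F : ℝ) = r ^ 2 := (Real.sq_sqrt (Nat.cast_nonneg _)).symm
  have hsymm (t : F) : (s • M + t • N).IsSymm := (hM.smul s).add (hN.smul t)
  have hterm (t : F) (ht : t ≠ 0) : ‖∑ v : ι → F, ψ (v ⬝ᵥ (s • M + t • N) *ᵥ v)‖
      ≤ r ^ k + if (s • M + t • N).det = 0 then r ^ (2 * k - 1) else 0 := by
    split_ifs with h
    · have hne : s • M + t • N ≠ 0 := by
        intro h0
        apply hMN (-(t⁻¹ * s))
        have h1 : t • N = -(s • M) := by rw [eq_neg_iff_add_eq_zero, add_comm, h0]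
        rw [neg_smul, mul_smul, ← smul_neg, ← h1, smul_smul, inv_mul_cancel₀ ht, one_smul]
      have hb := (hsymm t).norm_sum_addChar_le_of_ne_zero hF hψ hne
      rw [show 2 * Fintype.card ι = (2 * k - 1) + 1 by omega, pow_succ'] at hb
      have := le_of_mul_le_mul_left hb (by positivity)
      have : 0 ≤ r ^ k := by positivity
      linarith
    · rw [add_zero]
      exact (hsymm t).norm_sum_addChar_le_of_det_ne_zero hF hψ h
  calc ∑ t : F with t ≠ 0, ‖∑ v : ι → F, ψ (v ⬝ᵥ (s • M + t • N) *ᵥ v)‖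
      ≤ ∑ t : F with t ≠ 0,
          (r ^ k + if (s • M + t • N).det = 0 then r ^ (2 * k - 1) else 0) :=
        sum_le_sum fun t ht => hterm t (mem_filter.mp ht).2
    _ ≤ ∑ t : F, (r ^ k + if (s • M + t • N).det = 0 then r ^ (2 * k - 1) else 0) :=
        sum_le_sum_of_subset_of_nonneg (filter_subset _ _) fun t _ _ => by positivity
    _ = r ^ (k + 2) + #{t : F | (s • M + t • N).det = 0} * r ^ (2 * k - 1) := by
        rw [sum_add_distrib, ← sum_filter, sum_const, sum_const, nsmul_eq_mul, nsmul_eq_mul,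
          card_univ, hr2]
        ring
    _ ≤ r ^ (2 * k - 1) + k * r ^ (2 * k - 1) := by
        refine add_le_add (pow_le_pow_right₀ hr (by omega)) ?_
        refine mul_le_mul_of_nonneg_right ?_ (by positivity)
        exact_mod_cast Matrix.card_det_smul_add_smul_eq_zero_le hMdet N hs
    _ = _ := by ring

theorem quadChar_eq_quadraticChar {F : Type*} [Field F] [Fintype F] [DecidableEq F] (a : F) :
    quadChar a = (quadraticChar F a : ℝ) := by
  rw [quadChar, quadraticChar_apply, quadraticCharFun]
  split_ifs <;> simp

/-- The elementary bound behind `char_sum_two_quadrics`: expanding the quadratic character in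
additive characters reduces the sum to quadratic Gauss sums over the pencil spanned by `M`
and `N`. -/
theorem abs_sum_quadChar_mul_le {F : Type*} [Field F] [Fintype F] [DecidableEq F]
    (hF : ringChar F ≠ 2) {n : ℕ} (hn : 3 ≤ n) {M N : Matrix (Fin n) (Fin n) F}
    (hM : M.IsSymm) (hN : N.IsSymm) (hMdet : M.det ≠ 0) (hMN : ∀ c : F, N ≠ c • M) :
    |∑ v : Fin n → F, quadChar ((v ⬝ᵥ M *ᵥ v) * (v ⬝ᵥ N *ᵥ v))|
      ≤ ((Fintype.card F : ℝ) - 1) * ((n + 1) * √(Fintype.card F) ^ (2 * n - 3)) := by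
  let χ : MulChar F ℂ := (quadraticChar F).ringHomComp (Int.castRingHom ℂ)
  have hχ : χ.IsQuadratic := (quadraticChar_isQuadratic F).comp _
  have hχ1 : χ ≠ 1 :=
    (MulChar.ringHomComp_ne_one_iff (Int.castRingHom ℂ).injective_int).mpr
      (quadraticChar_ne_one hF)
  have hψ := AddChar.FiniteField.primitiveChar_to_Complex_isPrimitive F
  have h2 : (2 : F) ≠ 0 := Ring.two_ne_zero hF
  have hsum : |∑ v : Fin n → F, quadChar ((v ⬝ᵥ M *ᵥ v) * (v ⬝ᵥ N *ᵥ v))|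
      = ‖∑ v : Fin n → F, χ ((v ⬝ᵥ M *ᵥ v) * (v ⬝ᵥ N *ᵥ v))‖ := by
    rw [← Real.norm_eq_abs, ← Complex.norm_real, Complex.ofReal_sum]
    congr 1
    refine sum_congr rfl fun v _ => ?_
    rw [quadChar_eq_quadraticChar, Complex.ofReal_intCast]
    rfl
  have hq0 : (0 : ℝ) < Fintype.card F := by exact_mod_cast Fintype.card_pos
  have hsq : √(Fintype.card F : ℝ) ^ (2 * n - 1)
      = Fintype.card F * √(Fintype.card F : ℝ) ^ (2 * n - 3) := by
    rw [show 2 * n - 1 = 2 + (2 * n - 3) by omega, pow_add, Real.sq_sqrt hq0.le]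
  have hunits : (#{s : F | s ≠ 0} : ℝ) = (Fintype.card F : ℝ) - 1 := by
    rw [filter_ne', card_erase_of_mem (mem_univ _), card_univ, Nat.cast_pred Fintype.card_pos]
  rw [hsum]
  refine le_of_mul_le_mul_left ?_ hq0
  calc _ ≤ _ := norm_sum_mulChar_quadratic_mul_le hχ hχ1 hψ M N
    _ ≤ ∑ s : F with s ≠ 0, ((n : ℝ) + 1) * √(Fintype.card F : ℝ) ^ (2 * n - 1) := by
        refine sum_le_sum fun s hs => ?_
        simpa using sum_norm_sum_addChar_pencil_le h2 (by simpa using hn) hψ hM hN hMdet hMN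
          (mem_filter.mp hs).2
    _ = _ := by
        rw [sum_const, nsmul_eq_mul, hunits, hsq]
        ring

/-- Lemma 3.2: for `q ≥ 7` odd and distinct smooth quadrics `{f = 0}`, `{g = 0}` in
`ℙ^{n-1}`, `|Σ_{P ∈ ℙ^{n-1}(F_q)} χ(f(P)g(P))| ≤ 3·8^{n+1} q^{(2n-3)/2} + 2 q^{n-2}`,
expressed over nonzero vectors (hence the factor `q - 1`). -/
theorem char_sum_two_quadrics (q : ℕ) (hq7 : 7 ≤ q) (hq : Odd q)
    (F : Type) [Field F] [Fintype F] [DecidableEq F] (hcard : Fintype.card F = q)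
    (n : ℕ) (hn : 3 ≤ n)
    (M N : Matrix (Fin n) (Fin n) F) (hM : M.IsSymm) (hN : N.IsSymm)
    (hMdet : IsUnit M.det) (hNdet : IsUnit N.det)
    (hMN : ∀ c : F, N ≠ c • M) :
    abs (∑ v ∈ Finset.univ.filter (fun v : Fin n → F => v ≠ 0),
        quadChar ((v ⬝ᵥ M.mulVec v) * (v ⬝ᵥ N.mulVec v)))
      ≤ ((q : ℝ) - 1) *
          (3 * 8 ^ (n + 1) * (q : ℝ) ^ ((2 * (n : ℝ) - 3) / 2) + 2 * (q : ℝ) ^ (n - 2)) := by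
  subst hcard
  have hF : ringChar F ≠ 2 := by
    intro h
    have := FiniteField.even_card_of_char_two h
    rw [Nat.odd_iff] at hq
    omega
  have hbound := abs_sum_quadChar_mul_le hF hn hM hN hMdet.ne_zero hMN
  have hq1 : (1 : ℝ) ≤ Fintype.card F := by exact_mod_cast (by omega : 1 ≤ Fintype.card F)
  have hzero : ∑ v ∈ Finset.univ.filter (fun v : Fin n → F => v ≠ 0),
      quadChar ((v ⬝ᵥ M.mulVec v) * (v ⬝ᵥ N.mulVec v))
      = ∑ v : Fin n → F, quadChar ((v ⬝ᵥ M.mulVec v) * (v ⬝ᵥ N.mulVec v)) := by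
    refine sum_filter_of_ne fun v _ hv hv0 => hv ?_
    simp [hv0, quadChar]
  have hrpow : (Fintype.card F : ℝ) ^ ((2 * (n : ℝ) - 3) / 2)
      = √(Fintype.card F : ℝ) ^ (2 * n - 3) := by
    rw [Real.sqrt_eq_rpow, ← Real.rpow_mul_natCast (Nat.cast_nonneg _),
      Nat.cast_sub (by omega : 3 ≤ 2 * n)]
    congr 1
    push_cast
    ring
  have hn8 : (n : ℝ) + 1 ≤ 3 * 8 ^ (n + 1) := by
    have h : n + 1 < 8 ^ (n + 1) := Nat.lt_pow_self (by norm_num)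
    have h' : (n : ℝ) + 1 < 8 ^ (n + 1) := by exact_mod_cast h
    linarith
  rw [hzero, hrpow]
  refine hbound.trans (mul_le_mul_of_nonneg_left ?_ (by linarith))
  refine le_add_of_le_of_nonneg (mul_le_mul_of_nonneg_right hn8 (by positivity)) (by positivity)
end
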